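/- Let A, B be finite algebras in a Taylor variety and R a linked subdirect subalgebra of A × B. If C is a minimal absorbing subalgebra of A, then there exists a minimal absorbing subalgebra D of B such that C × D ⊆ R. -/

import Mathlib

structure Signature : Type 1 where
  symbols : Type
  arity : symbols → ℕ

structure UAlgebra (σ : Signature) : Type 1 where
  carrier : Type
  op : ∀ s : σ.symbols, (Fin (σ.arity s) → carrier) → carrier

inductive Term (σ : Signature) (n : ℕ) : Type
  | var : Fin n → Term σ n
  | app (s : σ.symbols) : (Fin (σ.arity s) → Term σ n) → Term σ n

def Term.eval {σ : Signature} (A : UAlgebra σ) {n : ℕ} :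
    Term σ n → (Fin n → A.carrier) → A.carrier
  | .var i, x => x i
  | .app s ts, x => A.op s fun j => Term.eval A (ts j) x

/-- `B` is a subuniverse of the algebra `A`. -/
def Subuniverse {σ : Signature} (A : UAlgebra σ) (B : Set A.carrier) : Prop :=
  ∀ (s : σ.symbols) (a : Fin (σ.arity s) → A.carrier), (∀ i, a i ∈ B) → A.op s a ∈ B

/-- `B` absorbs `A` with respect to the term `t`. -/
def AbsorbsWith {σ : Signature} (A : UAlgebra σ) (B : Set A.carrier) {n : ℕ} (t : Term σ n) : Prop :=
  ∀ (k : Fin n) (a : Fin n → A.carrier), (∀ i, i ≠ k → a i ∈ B) → t.eval A a ∈ B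

/-- `C` absorbs the subalgebra with universe `B` (inside the ambient algebra `A`)
with respect to the term `t`. -/
def AbsorbsWithIn {σ : Signature} (A : UAlgebra σ) (B C : Set A.carrier) {n : ℕ}
    (t : Term σ n) : Prop :=
  ∀ (k : Fin n) (a : Fin n → A.carrier), (∀ i, a i ∈ B) → (∀ i, i ≠ k → a i ∈ C) →
    t.eval A a ∈ C

/-- `B` is an absorbing subalgebra (subuniverse) of `A`. -/
def Absorbing {σ : Signature} (A : UAlgebra σ) (B : Set A.carrier) : Prop :=
  Subuniverse A B ∧ ∃ (n : ℕ) (t : Term σ n), AbsorbsWith A B t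

/-- `B` is a proper absorbing subalgebra of `A`: `∅ ≠ B ≠ A`. -/
def ProperAbsorbing {σ : Signature} (A : UAlgebra σ) (B : Set A.carrier) : Prop :=
  Absorbing A B ∧ B.Nonempty ∧ B ≠ Set.univ

/-- `C` is a minimal absorbing subalgebra of `A`. -/
def MinAbsorbing {σ : Signature} (A : UAlgebra σ) (C : Set A.carrier) : Prop :=
  Absorbing A C ∧ C.Nonempty ∧ ∀ C' ⊆ C, Absorbing A C' → C'.Nonempty → C' = C

/-- All (basic, equivalently term) operations of `A` are idempotent. -/
def Idempotent {σ : Signature} (A : UAlgebra σ) : Prop :=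
  ∀ (s : σ.symbols) (a : A.carrier), A.op s (fun _ => a) = a

/-- `t` is a Taylor term of the algebra `A`. -/
def IsTaylorTerm {σ : Signature} (A : UAlgebra σ) {k : ℕ} (t : Term σ k) : Prop :=
  (∀ a : A.carrier, t.eval A (fun _ => a) = a) ∧
  ∀ j : Fin k, ∃ u v : Fin k → Fin 2, u j = 0 ∧ v j = 1 ∧
    ∀ x : Fin 2 → A.carrier, t.eval A (fun i => x (u i)) = t.eval A (fun i => x (v i))

/-- The product of two algebras of the same signature. -/
def UAlgebra.prod {σ : Signature} (A B : UAlgebra σ) : UAlgebra σ where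
  carrier := A.carrier × B.carrier
  op s x := (A.op s fun i => (x i).1, B.op s fun i => (x i).2)

/-- The `k`-th power of an algebra. -/
def UAlgebra.pow {σ : Signature} (A : UAlgebra σ) (k : ℕ) : UAlgebra σ where
  carrier := Fin k → A.carrier
  op s x := fun j => A.op s fun i => x i j

/-- `R ⊆ A × B` is subdirect: both projections are onto. -/
def Subdirect2 {α β : Type} (R : Set (α × β)) : Prop :=
  (∀ a, ∃ b, (a, b) ∈ R) ∧ ∀ b, ∃ a, (a, b) ∈ R

/-- `a` and `a'` are linked in `R` (connected in the bipartite graph of `R`). -/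
def LinkedPair {α β : Type} (R : Set (α × β)) (a a' : α) : Prop :=
  Relation.ReflTransGen (fun x y => ∃ b, (x, b) ∈ R ∧ (y, b) ∈ R) a a'

/-- `R` is linked: any two elements of the projection of `R` to the first
coordinate are `R`-linked. -/
def IsLinked {α β : Type} (R : Set (α × β)) : Prop :=
  ∀ a a', (∃ b, (a, b) ∈ R) → (∃ b, (a', b) ∈ R) → LinkedPair R a a'

/-- Cyclic shift of a `k`-tuple. -/
def cycShift {α : Type} {k : ℕ} (x : Fin k → α) : Fin k → α := fun i =>
  x ⟨(i.val + 1) % k, Nat.mod_lt _ (Nat.lt_of_le_of_lt (Nat.zero_le _) i.isLt)⟩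

/-- `t` is a cyclic term of `A`: idempotent and invariant under cyclic shift. -/
def IsCyclicTerm {σ : Signature} (A : UAlgebra σ) {k : ℕ} (t : Term σ k) : Prop :=
  (∀ a : A.carrier, t.eval A (fun _ => a) = a) ∧
  ∀ x : Fin k → A.carrier, t.eval A x = t.eval A (cycShift x)


namespace Term

variable {σ : Signature} {m n : ℕ}

/-- Simultaneous substitution of terms for the variables of a term. -/
def subst : Term σ n → (Fin n → Term σ m) → Term σ m
  | .var i, g => g i
  | .app s ts, g => .app s fun j => subst (ts j) g

theorem eval_subst (A : UAlgebra σ) (f : Term σ n) (g : Fin n → Term σ m)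
    (x : Fin m → A.carrier) :
    (f.subst g).eval A x = f.eval A fun i => (g i).eval A x := by
  induction f with
  | var i => rfl
  | app s ts ih => simp only [subst, eval, ih]

/-- The star composition `f(g(…), …, g(…))`, with all variables distinct. -/
def star (f : Term σ m) (g : Term σ n) : Term σ (m * n) :=
  f.subst fun i => g.subst fun j => .var (finProdFinEquiv (i, j))

theorem eval_star (A : UAlgebra σ) (f : Term σ m) (g : Term σ n)
    (x : Fin (m * n) → A.carrier) :
    (f.star g).eval A x = f.eval A fun i => g.eval A fun j => x (finProdFinEquiv (i, j)) := by
  simp only [star, eval_subst, eval]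

theorem eval_const {A : UAlgebra σ} (hA : Idempotent A) (f : Term σ n) (a : A.carrier) :
    f.eval A (fun _ => a) = a := by
  induction f with
  | var i => rfl
  | app s ts ih => simp only [eval, ih, hA s a]

theorem eval_mem {A : UAlgebra σ} {S : Set A.carrier} (hS : Subuniverse A S) (f : Term σ n)
    {x : Fin n → A.carrier} (hx : ∀ i, x i ∈ S) : f.eval A x ∈ S := by
  induction f with
  | var i => exact hx i
  | app s ts ih => exact hS s _ ih

theorem eval_mem_rel {A B : UAlgebra σ} {R : Set (A.carrier × B.carrier)}
    (hR : Subuniverse (A.prod B) R) (f : Term σ n) {x : Fin n → A.carrier}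
    {y : Fin n → B.carrier} (h : ∀ i, (x i, y i) ∈ R) : (f.eval A x, f.eval B y) ∈ R := by
  induction f with
  | var i => exact h i
  | app s ts ih => exact hR s (fun j => ((ts j).eval A x, (ts j).eval B y)) ih

/-- `c` is a value of `f` at some tuple whose `i`-th entry is `b`. -/
def Reach (A : UAlgebra σ) (f : Term σ n) (i : Fin n) (b c : A.carrier) : Prop :=
  ∃ x : Fin n → A.carrier, x i = b ∧ f.eval A x = c

theorem reach_self {A : UAlgebra σ} (hA : Idempotent A) (f : Term σ n) (i : Fin n)
    (b : A.carrier) : f.Reach A i b b :=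
  ⟨fun _ => b, rfl, eval_const hA f b⟩

theorem Reach.star {A : UAlgebra σ} (hA : Idempotent A) {f : Term σ m} {g : Term σ n}
    {i : Fin m} {j : Fin n} {b c d : A.carrier} (hg : g.Reach A j b c) (hf : f.Reach A i c d) :
    (f.star g).Reach A (finProdFinEquiv (i, j)) b d := by
  obtain ⟨x, hxb, hxc⟩ := hg
  obtain ⟨y, hyc, hyd⟩ := hf
  refine ⟨fun p => if (finProdFinEquiv.symm p).1 = i then x (finProdFinEquiv.symm p).2
    else y (finProdFinEquiv.symm p).1, by simp [hxb], ?_⟩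
  rw [eval_star, ← hyd]
  congr 1
  funext i'
  by_cases h : i' = i
  · subst h
    simp [hxc, hyc]
  · simp [h, eval_const hA]

/-- The elements reachable in the coordinate `i` of `f` from every element of the algebra. -/
def reachTop (A : UAlgebra σ) (f : Term σ n) (i : Fin n) : Set A.carrier :=
  {c | ∀ b, f.Reach A i b c}

/-- `f` is transitive on `A`: every element is reachable from every element in each coordinate. -/
def Transitive (A : UAlgebra σ) (f : Term σ n) : Prop :=
  ∀ i b c, f.Reach A i b c

/-- The sets that contain `reachTop A f i` for some coordinate `i`. -/
def reachTopUpper (A : UAlgebra σ) (f : Term σ n) : Set (Set A.carrier) :=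
  {X | ∃ i, f.reachTop A i ⊆ X}

theorem reachTop_subset_star_left {A : UAlgebra σ} (hA : Idempotent A) (f : Term σ m)
    (g : Term σ n) (i : Fin m) (j : Fin n) :
    f.reachTop A i ⊆ (f.star g).reachTop A (finProdFinEquiv (i, j)) :=
  fun _ hc b => (g.reach_self hA j b).star hA (hc b)

theorem eval_mem_reachTop_star {A : UAlgebra σ} (hA : Idempotent A) (f : Term σ m)
    (g : Term σ n) (i : Fin m) (j : Fin n) (x : Fin m → A.carrier) (hx : x i ∈ g.reachTop A j) :
    f.eval A x ∈ (f.star g).reachTop A (finProdFinEquiv (i, j)) :=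
  fun b => (hx b).star hA ⟨x, rfl, rfl⟩

theorem reachTop_subset_star_right {A : UAlgebra σ} (hA : Idempotent A) (f : Term σ m)
    (g : Term σ n) (i : Fin m) (j : Fin n) :
    g.reachTop A j ⊆ (f.star g).reachTop A (finProdFinEquiv (i, j)) :=
  fun _ hc b => (hc b).star hA (f.reach_self hA i _)

theorem reachTopUpper_star_subset_left {A : UAlgebra σ} (hA : Idempotent A) (f : Term σ m)
    (g : Term σ n) : (f.star g).reachTopUpper A ⊆ f.reachTopUpper A := by
  rintro X ⟨p, hp⟩
  obtain ⟨⟨i, j⟩, rfl⟩ := finProdFinEquiv.surjective p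
  exact ⟨i, (reachTop_subset_star_left hA f g i j).trans hp⟩

theorem reachTopUpper_star_subset_right {A : UAlgebra σ} (hA : Idempotent A) (f : Term σ m)
    (g : Term σ n) : (f.star g).reachTopUpper A ⊆ g.reachTopUpper A := by
  rintro X ⟨p, hp⟩
  obtain ⟨⟨i, j⟩, rfl⟩ := finProdFinEquiv.surjective p
  exact ⟨j, (reachTop_subset_star_right hA f g i j).trans hp⟩

end Term

section Taylor

variable {σ : Signature} {A : UAlgebra σ} {k : ℕ} {t : Term σ k}

theorem IsTaylorTerm.exists_common_reach (ht : IsTaylorTerm A t) (i : Fin k) (b c : A.carrier) :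
    ∃ d, t.Reach A i b d ∧ t.Reach A i c d := by
  obtain ⟨u, v, hu, hv, h⟩ := ht.2 i
  exact ⟨_, ⟨fun l => ![b, c] (u l), by simp [hu], rfl⟩,
    ⟨fun l => ![b, c] (v l), by simp [hv], (h ![b, c]).symm⟩⟩

theorem IsTaylorTerm.exists_reachTop_nonempty [Finite A.carrier] [Nonempty A.carrier]
    (hA : Idempotent A) (ht : IsTaylorTerm A t) :
    ∃ (n : ℕ) (f : Term σ n), ∀ i, (f.reachTop A i).Nonempty := by
  classical
  have := Fintype.ofFinite A.carrier
  suffices h : ∀ Z : Finset A.carrier, ∃ (n : ℕ) (f : Term σ n), ∀ i, ∃ c, ∀ b ∈ Z,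
      f.Reach A i b c by
    obtain ⟨n, f, hf⟩ := h Finset.univ
    exact ⟨n, f, fun i => (hf i).imp fun c hc b => hc b (Finset.mem_univ b)⟩
  intro Z
  induction Z using Finset.induction_on with
  | empty => exact ⟨k, t, fun i => ⟨Classical.arbitrary _, by simp⟩⟩
  | insert a Z _ ih =>
    obtain ⟨n, f, hf⟩ := ih
    refine ⟨_, t.star f, fun p => ?_⟩
    obtain ⟨⟨i, j⟩, rfl⟩ := finProdFinEquiv.surjective p
    obtain ⟨c, hc⟩ := hf j
    obtain ⟨d, had, hcd⟩ := ht.exists_common_reach i a c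
    refine ⟨d, fun b hb => ?_⟩
    rcases Finset.mem_insert.1 hb with rfl | hb
    · exact (f.reach_self hA j _).star hA had
    · exact (hc b hb).star hA hcd

/-- A subuniverse that is an ideal in one coordinate of a Taylor term absorbs the algebra. -/
theorem IsTaylorTerm.absorbing_of_ideal (ht : IsTaylorTerm A t) {X : Set A.carrier}
    (hX : Subuniverse A X) (j : Fin k)
    (hj : ∀ x : Fin k → A.carrier, x j ∈ X → t.eval A x ∈ X) : Absorbing A X := by
  obtain ⟨u, v, hu, hv, h⟩ := ht.2 j
  refine ⟨hX, 2, t.subst fun i => .var (u i), fun l a ha => ?_⟩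
  rw [Term.eval_subst]
  simp only [Term.eval]
  by_cases hl : l = 0
  · rw [h a]
    exact hj _ (by rw [hv]; exact ha 1 (by simp [hl]))
  · exact hj _ (by rw [hu]; exact ha 0 (Ne.symm hl))

/-- The algebra has no proper nonempty absorbing subuniverse. -/
def AbsorptionFree (A : UAlgebra σ) : Prop :=
  ∀ E : Set A.carrier, Absorbing A E → E.Nonempty → E = Set.univ

theorem AbsorptionFree.exists_transitive [Finite A.carrier] [Nonempty A.carrier]
    (hfree : AbsorptionFree A) (hA : Idempotent A) (ht : IsTaylorTerm A t) :
    ∃ (n : ℕ) (f : Term σ n), f.Transitive A := by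
  obtain ⟨n₀, f₀, hf₀⟩ := ht.exists_reachTop_nonempty hA
  obtain ⟨_, ⟨⟨n, f⟩, rfl⟩, hmin⟩ := (wellFounded_lt (α := Set (Set A.carrier))).has_min
    (Set.range fun p : Σ n, Term σ n => p.2.reachTopUpper A) ⟨_, ⟨⟨k, t⟩, rfl⟩⟩
  have heq : ∀ {m : ℕ} (g : Term σ m), (g.star f).reachTopUpper A = f.reachTopUpper A :=
    fun g => by
      by_contra hne
      exact hmin _ ⟨⟨_, g.star f⟩, rfl⟩
        ((Term.reachTopUpper_star_subset_right hA g f).ssubset_of_ne hne)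
  refine ⟨n, f, fun i => ?_⟩
  obtain ⟨_, ⟨⟨i₀, rfl⟩, hi₀⟩, hmin₀⟩ := (wellFounded_lt (α := Set A.carrier)).has_min
    (Set.range (f.reachTop A) ∩ Set.Iic (f.reachTop A i)) ⟨_, ⟨i, rfl⟩, Set.self_mem_Iic⟩
  set X := f.reachTop A i₀ with hXdef
  have hXmem : X ∈ f.reachTopUpper A := ⟨i₀, subset_rfl⟩
  have hideal : ∀ {m : ℕ} (g : Term σ m), ∃ j, ∀ x : Fin m → A.carrier, x j ∈ X →
      g.eval A x ∈ X := by
    intro m g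
    obtain ⟨p, hp⟩ : X ∈ (g.star f).reachTopUpper A := by rwa [heq]
    obtain ⟨⟨j, l⟩, rfl⟩ := finProdFinEquiv.surjective p
    have hl : f.reachTop A l ⊆ X := (Term.reachTop_subset_star_right hA g f j l).trans hp
    have hlX : f.reachTop A l = X := by
      by_contra hne
      exact hmin₀ _ ⟨⟨l, rfl⟩, hl.trans hi₀⟩ (hl.ssubset_of_ne hne)
    exact ⟨j, fun x hx => hp (Term.eval_mem_reachTop_star hA g f j l x (by rwa [hlX]))⟩
  have hXne : X.Nonempty := by
    obtain ⟨j, hj⟩ := Term.reachTopUpper_star_subset_left hA f₀ f (by rwa [heq] : X ∈ _)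
    exact (hf₀ j).mono hj
  have hXsub : Subuniverse A X := by
    intro s a ha
    obtain ⟨j, hj⟩ := hideal (.app s Term.var)
    exact hj a (ha j)
  obtain ⟨j, hj⟩ := hideal t
  have hXuniv : X = Set.univ := hfree X (ht.absorbing_of_ideal hXsub j hj) hXne
  intro b c
  exact hi₀ (hXuniv ▸ Set.mem_univ c : c ∈ X) b

end Taylor

section Center

variable {σ : Signature} {A B : UAlgebra σ} {n : ℕ} {f : Term σ n}

/-- The center of a relation whose left-hand algebra has a transitive term is absorbing. -/
theorem Term.Transitive.absorbing_center (hf : f.Transitive A) (hA : Idempotent A)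
    {R : Set (A.carrier × B.carrier)} (hR : Subuniverse (A.prod B) R)
    (hsurj : ∀ b, ∃ a, (a, b) ∈ R) : Absorbing B {b | ∀ a, (a, b) ∈ R} := by
  refine ⟨fun s b hb a => ?_, n, f, fun i b hb a => ?_⟩
  · have h := hR s (fun i => (a, b i)) fun i => hb i a
    simp only [UAlgebra.prod, hA s a] at h
    exact h
  · obtain ⟨a', ha'⟩ := hsurj (b i)
    obtain ⟨x, hx, rfl⟩ := hf i a' a
    refine Term.eval_mem_rel hR f fun j => ?_
    by_cases hj : j = i
    · rw [hj, hx]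
      exact ha'
    · exact hb j hj _

theorem AbsorptionFree.eq_univ_of_center (hB : AbsorptionFree B) (hf : f.Transitive A)
    (hA : Idempotent A) {R : Set (A.carrier × B.carrier)} (hR : Subuniverse (A.prod B) R)
    (hsurj : ∀ b, ∃ a, (a, b) ∈ R) (hcenter : ∃ b, ∀ a, (a, b) ∈ R) : R = Set.univ := by
  have h := hB _ (hf.absorbing_center hA hR hsurj) hcenter
  refine Set.eq_univ_of_forall fun ⟨a, b⟩ => ?_
  exact (h ▸ Set.mem_univ b : b ∈ {b | ∀ a, (a, b) ∈ R}) a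

theorem AbsorptionFree.exists_center_of_pairs [Finite A.carrier] [Nonempty A.carrier]
    (hfree : AbsorptionFree A) (hf : f.Transitive A) (hA : Idempotent A)
    {R : Set (A.carrier × B.carrier)} (hR : Subuniverse (A.prod B) R)
    (hpairs : ∀ a a', ∃ b, (a, b) ∈ R ∧ (a', b) ∈ R) : ∃ b, ∀ a, (a, b) ∈ R := by
  classical
  have := Fintype.ofFinite A.carrier
  suffices h : ∀ Z : Finset A.carrier, ∀ x y, ∃ b, (x, b) ∈ R ∧ (y, b) ∈ R ∧
      ∀ z ∈ Z, (z, b) ∈ R by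
    obtain ⟨b, -, -, hb⟩ := h Finset.univ (Classical.arbitrary _) (Classical.arbitrary _)
    exact ⟨b, fun a => hb a (Finset.mem_univ a)⟩
  intro Z
  induction Z using Finset.induction_on with
  | empty => simpa using hpairs
  | insert c Z _ ih =>
    let Q : Set (A.carrier × A.carrier) :=
      {p | ∃ b, (p.1, b) ∈ R ∧ (p.2, b) ∈ R ∧ ∀ z ∈ insert c Z, (z, b) ∈ R}
    have hQ : Subuniverse (A.prod A) Q := by
      intro s p hp
      choose b hb₁ hb₂ hbZ using hp
      refine ⟨B.op s b, hR s (fun i => ((p i).1, b i)) hb₁, hR s (fun i => ((p i).2, b i)) hb₂,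
        fun z hz => ?_⟩
      have h := hR s (fun i => (z, b i)) fun i => hbZ i z hz
      simp only [UAlgebra.prod, hA s z] at h
      exact h
    have hQc : ∀ x y, x = c ∨ y = c → (x, y) ∈ Q := by
      intro x y hxy
      obtain ⟨b, hx, hy, hZ⟩ := ih x y
      refine ⟨b, hx, hy, fun z hz => ?_⟩
      rcases Finset.mem_insert.1 hz with rfl | hz
      · rcases hxy with rfl | rfl
        exacts [hx, hy]
      · exact hZ z hz
    have huniv := hfree.eq_univ_of_center hf hA hQ (fun y => ⟨c, hQc c y (.inl rfl)⟩)
      ⟨c, fun x => hQc x c (.inr rfl)⟩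
    intro x y
    exact (huniv ▸ Set.mem_univ (x, y) : (x, y) ∈ Q)

theorem AbsorptionFree.eq_univ_of_reflTransGen [Finite A.carrier] [Nonempty A.carrier]
    (hfree : AbsorptionFree A) (hf : f.Transitive A) (hA : Idempotent A)
    {Q : Set (A.carrier × A.carrier)} (hQ : Subuniverse (A.prod A) Q)
    (hrefl : ∀ a, (a, a) ∈ Q) (hsymm : ∀ a b, (a, b) ∈ Q → (b, a) ∈ Q)
    (hconn : ∀ a b, Relation.ReflTransGen (fun x y => (x, y) ∈ Q) a b) : Q = Set.univ := by
  induction Q using (wellFounded_gt (α := Set (A.carrier × A.carrier))).induction with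
  | _ Q ih =>
  let Q₂ : Set (A.carrier × A.carrier) := {p | ∃ b, (p.1, b) ∈ Q ∧ (b, p.2) ∈ Q}
  have hle : Q ⊆ Q₂ := fun p hp => ⟨p.2, hp, hrefl _⟩
  by_cases heq : Q = Q₂
  · refine Set.eq_univ_of_forall fun ⟨a, b⟩ => ?_
    refine Relation.ReflTransGen.trans_induction_on
      (motive := fun {a b} _ => (a, b) ∈ Q) (hconn a b) hrefl id ?_
    intro a b c _ _ hab hbc
    rw [heq]
    exact ⟨b, hab, hbc⟩
  · have hQ₂ : Subuniverse (A.prod A) Q₂ := by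
      intro s p hp
      choose b hb₁ hb₂ using hp
      exact ⟨A.op s b, hQ s (fun i => ((p i).1, b i)) hb₁, hQ s (fun i => (b i, (p i).2)) hb₂⟩
    have huniv : Q₂ = Set.univ := ih Q₂ (hle.ssubset_of_ne heq) hQ₂ (fun a => hle (hrefl a))
      (fun a b ⟨c, h₁, h₂⟩ => ⟨c, hsymm _ _ h₂, hsymm _ _ h₁⟩)
      (fun a b => Relation.ReflTransGen.mono (fun _ _ h => hle h) _ _ (hconn a b))
    refine hfree.eq_univ_of_center hf hA hQ (fun b => ⟨b, hrefl b⟩)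
      (hfree.exists_center_of_pairs hf hA hQ fun a a' => ?_)
    obtain ⟨b, h₁, h₂⟩ : (a, a') ∈ Q₂ := huniv ▸ Set.mem_univ _
    exact ⟨b, h₁, hsymm _ _ h₂⟩

/-- The absorption theorem: a linked subdirect relation between finite absorption-free algebras,
the first of which has a Taylor term, is the full product. -/
theorem AbsorptionFree.eq_univ_of_isLinked [Finite A.carrier] [Nonempty A.carrier]
    (hAfree : AbsorptionFree A) (hBfree : AbsorptionFree B)
    (hA : Idempotent A) {k : ℕ} {t : Term σ k} (ht : IsTaylorTerm A t)
    {R : Set (A.carrier × B.carrier)} (hR : Subuniverse (A.prod B) R) (hsub : Subdirect2 R)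
    (hlink : IsLinked R) : R = Set.univ := by
  obtain ⟨n, f, hf⟩ := hAfree.exists_transitive hA ht
  let T : Set (A.carrier × A.carrier) := {p | ∃ b, (p.1, b) ∈ R ∧ (p.2, b) ∈ R}
  have hT : Subuniverse (A.prod A) T := by
    intro s p hp
    choose b hb₁ hb₂ using hp
    exact ⟨B.op s b, hR s (fun i => ((p i).1, b i)) hb₁, hR s (fun i => ((p i).2, b i)) hb₂⟩
  have huniv : T = Set.univ := hAfree.eq_univ_of_reflTransGen hf hA hT
    (fun a => (hsub.1 a).imp fun _ h => ⟨h, h⟩) (fun a b ⟨c, h₁, h₂⟩ => ⟨c, h₂, h₁⟩)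
    (fun a b => hlink a b (hsub.1 a) (hsub.1 b))
  refine hBfree.eq_univ_of_center hf hA hR hsub.2
    (hAfree.exists_center_of_pairs hf hA hR fun a a' => ?_)
  exact (huniv ▸ Set.mem_univ (a, a') : (a, a') ∈ T)

end Center

section Absorption

variable {σ : Signature} {A B : UAlgebra σ} {m n : ℕ}

theorem AbsorbsWith.star_left {S : Set A.carrier} {f : Term σ m} (hf : AbsorbsWith A S f)
    (hS : Subuniverse A S) (g : Term σ n) : AbsorbsWith A S (g.star f) := by
  intro p a ha
  rw [Term.eval_star]
  obtain ⟨⟨i, j⟩, rfl⟩ := finProdFinEquiv.surjective p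
  refine Term.eval_mem hS g fun i' => hf j _ fun j' hj' => ha _ ?_
  simp [hj']

theorem AbsorbsWith.star_right {S : Set A.carrier} {f : Term σ m} (hf : AbsorbsWith A S f)
    (hS : Subuniverse A S) (g : Term σ n) : AbsorbsWith A S (f.star g) := by
  intro p a ha
  rw [Term.eval_star]
  obtain ⟨⟨i, j⟩, rfl⟩ := finProdFinEquiv.surjective p
  refine hf i _ fun i' hi' => Term.eval_mem hS g fun j' => ha _ ?_
  simp [hi']

theorem Absorbing.inter {S T : Set A.carrier} (hS : Absorbing A S) (hT : Absorbing A T) :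
    Absorbing A (S ∩ T) := by
  obtain ⟨hSs, m, f, hf⟩ := hS
  obtain ⟨hTs, n, g, hg⟩ := hT
  exact ⟨fun s a ha => ⟨hSs s a fun i => (ha i).1, hTs s a fun i => (ha i).2⟩, _, f.star g,
    fun i a ha => ⟨hf.star_right hSs g i a fun j hj => (ha j hj).1,
      hg.star_left hTs f i a fun j hj => (ha j hj).2⟩⟩

theorem Absorbing.image_rel {R : Set (A.carrier × B.carrier)} (hR : Subuniverse (A.prod B) R)
    (hsurj : ∀ b, ∃ a, (a, b) ∈ R) {S : Set A.carrier} (hS : Absorbing A S) :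
    Absorbing B {b | ∃ a ∈ S, (a, b) ∈ R} := by
  obtain ⟨hSs, n, f, hf⟩ := hS
  refine ⟨fun s b hb => ?_, n, f, fun i b hb => ?_⟩
  · choose a ha hab using hb
    exact ⟨_, hSs s a ha, hR s (fun i => (a i, b i)) hab⟩
  · have h : ∀ j, ∃ a, (a, b j) ∈ R ∧ (j ≠ i → a ∈ S) := by
      intro j
      by_cases hj : j = i
      · exact (hsurj (b j)).imp fun a ha => ⟨ha, fun h => absurd hj h⟩
      · obtain ⟨a, ha, hab⟩ := hb j hj
        exact ⟨a, hab, fun _ => ha⟩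
    choose a hab ha using h
    exact ⟨_, hf i a ha, Term.eval_mem_rel hR f hab⟩

theorem Subuniverse.swap {R : Set (A.carrier × B.carrier)} (hR : Subuniverse (A.prod B) R) :
    Subuniverse (B.prod A) {p : B.carrier × A.carrier | (p.2, p.1) ∈ R} :=
  fun s p hp => hR s (fun i => ((p i).2, (p i).1)) hp

theorem Absorbing.exists_minAbsorbing_subset [Finite A.carrier] {S : Set A.carrier}
    (hS : Absorbing A S) (hne : S.Nonempty) : ∃ D ⊆ S, MinAbsorbing A D := by
  obtain ⟨D, ⟨hD, hDne, hDS⟩, hmin⟩ := (wellFounded_lt (α := Set A.carrier)).has_min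
    {D | Absorbing A D ∧ D.Nonempty ∧ D ⊆ S} ⟨S, hS, hne, subset_rfl⟩
  refine ⟨D, hDS, hD, hDne, fun C hC hCabs hCne => ?_⟩
  by_contra h
  exact hmin C ⟨hCabs, hCne, hC.trans hDS⟩ (hC.ssubset_of_ne h)

/-- Links in `R` between elements of an absorbing subrelation `S` can be taken within `S`. -/
theorem LinkedPair.of_absorbing (hA : Idempotent A) {R S : Set (A.carrier × B.carrier)}
    {f : Term σ n}
    (habs : ∀ (i : Fin n) (x : Fin n → A.carrier) (y : Fin n → B.carrier),
      (∀ j, (x j, y j) ∈ R) → (∀ j, j ≠ i → (x j, y j) ∈ S) → (f.eval A x, f.eval B y) ∈ S)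
    (hSR : S ⊆ R) {c c' : A.carrier} {d d' : B.carrier} (hc : (c, d) ∈ S) (hc' : (c', d') ∈ S)
    (hlink : LinkedPair R c c') : LinkedPair S c c' := by
  classical
  have step : ∀ (i : Fin n) (x : Fin n → A.carrier) (y : Fin n → B.carrier),
      (∀ j, j ≠ i → (x j, y j) ∈ S) →
      LinkedPair S (f.eval A (Function.update x i c)) (f.eval A (Function.update x i c')) := by
    intro i x y hxy
    refine Relation.ReflTransGen.lift (fun z => f.eval A (Function.update x i z)) ?_ _ _ hlink
    rintro a a' ⟨b, hab, hab'⟩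
    have key : ∀ z, (z, b) ∈ R →
        (f.eval A (Function.update x i z), f.eval B (Function.update y i b)) ∈ S := by
      intro z hz
      refine habs i _ _ (fun j => ?_) fun j hj => ?_
      · by_cases hj : j = i
        · subst hj
          simpa using hz
        · simpa [hj] using hSR (hxy j hj)
      · simpa [hj] using hxy j hj
    exact ⟨_, key a hab, key a' hab'⟩
  have main : ∀ Z : Finset (Fin n),
      LinkedPair S c (f.eval A fun j => if j ∈ Z then c' else c) := by
    intro Z
    induction Z using Finset.induction_on with
    | empty =>
      simp only [Finset.notMem_empty, if_false, Term.eval_const hA]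
      exact Relation.ReflTransGen.refl
    | insert i Z hi ih =>
      have h := step i (fun j => if j ∈ Z then c' else c) (fun j => if j ∈ Z then d' else d)
        fun j _ => by by_cases hj : j ∈ Z <;> simp [hj, hc, hc']
      have h₁ : Function.update (fun j => if j ∈ Z then c' else c) i c =
          fun j => if j ∈ Z then c' else c := by
        funext j
        by_cases hj : j = i
        · subst hj
          simp [hi]
        · simp [hj]
      have h₂ : Function.update (fun j => if j ∈ Z then c' else c) i c' =
          fun j => if j ∈ insert i Z then c' else c := by
        funext j
        by_cases hj : j = i
        · subst hj
          simp
        · simp [hj]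
      rw [h₁, h₂] at h
      exact Relation.ReflTransGen.trans ih h
  have h := main Finset.univ
  simpa only [Finset.mem_univ, if_true, Term.eval_const hA] using h

end Absorption

section Subalgebra

variable {σ : Signature} {A B : UAlgebra σ}

/-- The subalgebra with a given universe. -/
def UAlgebra.sub (A : UAlgebra σ) (C : Set A.carrier) (hC : Subuniverse A C) : UAlgebra σ where
  carrier := C
  op s x := ⟨A.op s fun i => (x i : A.carrier), hC s _ fun i => (x i).2⟩

theorem Term.coe_eval_sub {C : Set A.carrier} (hC : Subuniverse A C) {n : ℕ} (f : Term σ n)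
    (x : Fin n → C) :
    Subtype.val (p := (· ∈ C)) (f.eval (A.sub C hC) x) = f.eval A fun i => (x i : A.carrier) := by
  induction f with
  | var i => rfl
  | app s ts ih => exact congrArg (A.op s) (funext ih)

theorem Idempotent.sub (hA : Idempotent A) {C : Set A.carrier} (hC : Subuniverse A C) :
    Idempotent (A.sub C hC) :=
  fun s a => Subtype.ext (hA s (Subtype.val a))

theorem IsTaylorTerm.sub {k : ℕ} {t : Term σ k} (ht : IsTaylorTerm A t) {C : Set A.carrier}
    (hC : Subuniverse A C) : IsTaylorTerm (A.sub C hC) t := by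
  refine ⟨fun a => Subtype.ext ?_, fun j => ?_⟩
  · exact (Term.coe_eval_sub hC t _).trans (ht.1 (Subtype.val a))
  · obtain ⟨u, v, hu, hv, h⟩ := ht.2 j
    refine ⟨u, v, hu, hv, fun x => Subtype.ext ?_⟩
    exact (Term.coe_eval_sub hC t _).trans
      ((h fun i => Subtype.val (x i)).trans (Term.coe_eval_sub hC t _).symm)

theorem Absorbing.of_sub {C : Set A.carrier} (hC : Absorbing A C) {E : Set C}
    (hE : Absorbing (A.sub C hC.1) E) : Absorbing A (Subtype.val '' E) := by
  obtain ⟨hCs, n, f, hf⟩ := hC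
  obtain ⟨hEs, m, g, hg⟩ := hE
  have hsub : Subuniverse A (Subtype.val '' E) := by
    intro s a ha
    choose e he hea using ha
    obtain rfl : (fun i => (e i : A.carrier)) = a := funext hea
    exact ⟨_, hEs s e he, rfl⟩
  refine ⟨hsub, _, g.star f, fun p a ha => ?_⟩
  obtain ⟨⟨i, j⟩, rfl⟩ := finProdFinEquiv.surjective p
  rw [Term.eval_star]
  have hin : ∀ i', i' ≠ i →
      (f.eval A fun j' => a (finProdFinEquiv (i', j'))) ∈ Subtype.val '' E :=
    fun i' hi' => Term.eval_mem hsub f fun j' => ha _ (by simp [hi'])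
  have hmem : ∀ i', (f.eval A fun j' => a (finProdFinEquiv (i', j'))) ∈ C := by
    intro i'
    refine hf j _ fun j' hj' => ?_
    obtain ⟨e, -, he⟩ := ha (finProdFinEquiv (i', j')) (by simp [hj'])
    exact he ▸ e.2
  refine ⟨_, hg i (fun i' => ⟨_, hmem i'⟩) fun i' hi' => ?_, Term.coe_eval_sub hCs g _⟩
  obtain ⟨e, he, hee⟩ := hin i' hi'
  have : e = ⟨_, hmem i'⟩ := Subtype.ext hee
  exact this ▸ he

theorem MinAbsorbing.absorptionFree_sub {C : Set A.carrier} (hC : MinAbsorbing A C) :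
    AbsorptionFree (A.sub C hC.1.1) := by
  intro E hE hne
  have h := hC.2.2 (Subtype.val '' E) (Subtype.coe_image_subset C E) (hC.1.of_sub hE)
    (hne.image _)
  refine Set.eq_univ_of_forall fun x => ?_
  have hx : (Subtype.val x : A.carrier) ∈ Subtype.val '' E := h.symm ▸ Subtype.prop x
  obtain ⟨e, he, hex⟩ := hx
  exact (Subtype.ext hex : e = x) ▸ he

end Subalgebra

/-- If `R ≤ A × B` is linked and subdirect and `C ◁◁ A`, then
there exists `D ◁◁ B` with `C × D ⊆ R`. -/
theorem minabs_exists_product {σ : Signature} (A B : UAlgebra σ)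
    [Fintype A.carrier] [Fintype B.carrier]
    (hIA : Idempotent A) (hIB : Idempotent B)
    {k : ℕ} (t : Term σ k) (hTA : IsTaylorTerm A t) (hTB : IsTaylorTerm B t)
    (R : Set (A.carrier × B.carrier)) (hR : Subuniverse (A.prod B) R)
    (hsub : Subdirect2 R) (hlink : IsLinked R)
    (C : Set A.carrier) (hC : MinAbsorbing A C) :
    ∃ D : Set B.carrier, MinAbsorbing B D ∧ C ×ˢ D ⊆ R := by
  obtain ⟨D, hDsub, hD⟩ := (hC.1.image_rel hR hsub.2).exists_minAbsorbing_subset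
    (by
      obtain ⟨c, hc⟩ := hC.2.1
      obtain ⟨b, hb⟩ := hsub.1 c
      exact ⟨b, c, hc, hb⟩)
  have hCD : ∀ c ∈ C, ∃ d ∈ D, (c, d) ∈ R := by
    have habs : Absorbing A {a | ∃ d ∈ D, (a, d) ∈ R} := hD.1.image_rel hR.swap hsub.1
    obtain ⟨d, hd⟩ := hD.2.1
    obtain ⟨c, hc, hcd⟩ := hDsub hd
    have h := hC.2.2 _ Set.inter_subset_left (hC.1.inter habs) ⟨c, hc, d, hd, hcd⟩
    exact fun c hc => (h.symm ▸ hc : c ∈ C ∩ {a | ∃ d ∈ D, (a, d) ∈ R}).2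
  have hlinkS : ∀ c c', c ∈ C → c' ∈ C → LinkedPair (R ∩ C ×ˢ D) c c' := by
    intro c c' hc hc'
    obtain ⟨d, hd, hcd⟩ := hCD c hc
    obtain ⟨d', hd', hcd'⟩ := hCD c' hc'
    obtain ⟨hCs, m, f, hf⟩ := hC.1
    obtain ⟨hDs, n, g, hg⟩ := hD.1
    exact LinkedPair.of_absorbing (R := R) (S := R ∩ C ×ˢ D) (f := f.star g) hIA
      (fun i x y hxy h => ⟨Term.eval_mem_rel hR _ hxy,
        hf.star_right hCs g i x fun j hj => (h j hj).2.1,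
        hg.star_left hDs f i y fun j hj => (h j hj).2.2⟩)
      Set.inter_subset_left ⟨hcd, hc, hd⟩ ⟨hcd', hc', hd'⟩ (hlink c c' ⟨d, hcd⟩ ⟨d', hcd'⟩)
  refine ⟨D, hD, ?_⟩
  let A' := A.sub C hC.1.1
  let B' := B.sub D hD.1.1
  let S : Set (A'.carrier × B'.carrier) := {p | (Subtype.val p.1, Subtype.val p.2) ∈ R}
  have : Finite A'.carrier := inferInstanceAs (Finite C)
  have : Nonempty A'.carrier := hC.2.1.to_subtype
  have hS : Subuniverse (A'.prod B') S := fun s p hp =>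
    hR s (fun i => (Subtype.val (p i).1, Subtype.val (p i).2)) hp
  have hSsub : Subdirect2 S := by
    refine ⟨fun c => ?_, fun d => ?_⟩
    · obtain ⟨d, hd, h⟩ := hCD (Subtype.val c) (Subtype.prop c)
      exact ⟨⟨d, hd⟩, h⟩
    · obtain ⟨c, hc, h⟩ := hDsub (Subtype.prop d)
      exact ⟨⟨c, hc⟩, h⟩
  have hSlink : IsLinked S := by
    intro c c' _ _
    have key : ∀ a, LinkedPair (R ∩ C ×ˢ D) (Subtype.val c) a →
        ∃ h : a ∈ C, LinkedPair S c ⟨a, h⟩ := by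
      intro a ha
      induction ha with
      | refl => exact ⟨Subtype.prop c, .refl⟩
      | tail _ h ih =>
        obtain ⟨b, h₁, h₂⟩ := h
        obtain ⟨hx, ih⟩ := ih
        exact ⟨h₂.2.1, ih.tail ⟨⟨b, h₁.2.2⟩, h₁.1, h₂.1⟩⟩
    exact (key _ (hlinkS _ _ (Subtype.prop c) (Subtype.prop c'))).2
  have huniv : S = Set.univ := hC.absorptionFree_sub.eq_univ_of_isLinked
    hD.absorptionFree_sub (hIA.sub _) (hTA.sub _) hS hSsub hSlink
  rintro ⟨c, d⟩ ⟨hc, hd⟩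
  exact (huniv ▸ Set.mem_univ _ : ((⟨c, hc⟩, ⟨d, hd⟩) : A'.carrier × B'.carrier) ∈ S)
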